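/- Assume constants range over a Primcodable (computably encoded) type with computable equality, each interpreted function is computable, and each interpreted relation is computable. Then the model checking problem for PTLTL^FO+ (PTLTL^FO with positive guards) is decidable: there is a computable function which, given a history h and a closed PTLTL^FO+ formula φ, returns true if h ⊨ φ and false otherwise. -/

import Mathlib

/-- Terms: variables, constants, and applications of interpreted function symbols
(function symbols are named by natural numbers). -/
inductive Tm (C : Type) : Type where
  | var : ℕ → Tm C
  | const : C → Tm C
  | func : ℕ → List (Tm C) → Tm C

/-- Evaluation of a term under an interpretation `F` of the function symbols and an
environment (variable assignment) `ρ`. -/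
def Tm.eval {C : Type} (F : ℕ → List C → C) (ρ : ℕ → C) : Tm C → C
  | .var x => ρ x
  | .const c => c
  | .func f args => F f (args.attach.map fun t => Tm.eval F ρ t.1)
  decreasing_by simp_wf; have := List.sizeOf_lt_of_mem t.2; omega

/-- Variables occurring in a term. -/
def Tm.fv {C : Type} : Tm C → List ℕ
  | .var x => [x]
  | .const _ => []
  | .func _ args => args.attach.flatMap fun t => Tm.fv t.1
  decreasing_by simp_wf; have := List.sizeOf_lt_of_mem t.2; omega

/-- PTLTL^FO formulas: uninterpreted predicate atoms, interpreted relation atoms,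
conjunction, negation, "previous" X⁻¹, "since" S, and the guarded universal
quantifier `all xs p ψ` (∀(x₁,…,xₙ):p. ψ). -/
inductive Fm (C : Type) : Type where
  | atom : ℕ → List (Tm C) → Fm C
  | rel : ℕ → List (Tm C) → Fm C
  | and : Fm C → Fm C → Fm C
  | not : Fm C → Fm C
  | prev : Fm C → Fm C
  | since : Fm C → Fm C → Fm C
  | all : List ℕ → ℕ → Fm C → Fm C

/-- Free variables of a formula. -/
def Fm.fv {C : Type} : Fm C → List ℕ
  | .atom _ ts => ts.flatMap Tm.fv
  | .rel _ ts => ts.flatMap Tm.fv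
  | .and a b => a.fv ++ b.fv
  | .not a => a.fv
  | .prev a => a.fv
  | .since a b => a.fv ++ b.fv
  | .all xs _ a => a.fv.filter (fun v => v ∉ xs)

/-- A formula is closed if it has no free variables. -/
def Fm.Closed {C : Type} (φ : Fm C) : Prop := φ.fv = []

/-- A session is a finite set of events `p(c₁,…,cₙ)`. -/
abbrev Session (C : Type) := Finset (ℕ × List C)

/-- A history is a (finite) list of sessions. -/
abbrev History (C : Type) := List (Session C)

/-- Update an environment on the list of variables `xs` with the list of values `cs`. -/
def updEnv {C : Type} (ρ : ℕ → C) (xs : List ℕ) (cs : List C) : ℕ → C :=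
  fun v => ((xs.zip cs).lookup v).getD (ρ v)

/-- The forcing relation `(h,i) ⊨ φ` (1-based session index `i`, environment `ρ`),
with interpretation `F` of function symbols and `R` of relation symbols. -/
def Sat {C : Type} (F : ℕ → List C → C) (R : ℕ → List C → Bool) (h : History C) :
    ℕ → (ℕ → C) → Fm C → Prop
  | i, ρ, .atom p ts => (p, ts.map (Tm.eval F ρ)) ∈ h.getD (i - 1) ∅
  | i, ρ, .rel r ts => R r (ts.map (Tm.eval F ρ)) = true
  | i, ρ, .and a b => Sat F R h i ρ a ∧ Sat F R h i ρ b
  | i, ρ, .not a => ¬ Sat F R h i ρ a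
  | i, ρ, .prev a => 1 < i ∧ Sat F R h (i - 1) ρ a
  | i, ρ, .since a b =>
      ∃ j, 1 ≤ j ∧ j ≤ i ∧ Sat F R h j ρ b ∧ ∀ k, j < k → k ≤ i → Sat F R h k ρ a
  | i, ρ, .all xs p a =>
      ∀ cs : List C, cs.length = xs.length → (p, cs) ∈ h.getD (i - 1) ∅ →
        Sat F R h i (updEnv ρ xs cs) a

/-- Simple guards `γ ::= p(u⃗) | γ∧γ | G⁻¹γ | F⁻¹γ`, where the arguments `u⃗` of an atom
are variables (`Sum.inl`) or constants (`Sum.inr`); no function symbols are allowed. -/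
inductive SG (C : Type) : Type where
  | atom : ℕ → List (ℕ ⊕ C) → SG C
  | and : SG C → SG C → SG C
  | galw : SG C → SG C
  | fsome : SG C → SG C

/-- Positive guards `G ::= γ | G∧G | G∨G | G⁻¹G | F⁻¹G | G S G`. -/
inductive PG (C : Type) : Type where
  | simple : SG C → PG C
  | and : PG C → PG C → PG C
  | or : PG C → PG C → PG C
  | galw : PG C → PG C
  | fsome : PG C → PG C
  | since : PG C → PG C → PG C

/-- Semantics of simple guards (environment `ρ`, 1-based session index `i`). -/
def SG.sat {C : Type} (h : History C) : ℕ → (ℕ → C) → SG C → Prop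
  | i, ρ, .atom p args => (p, args.map (Sum.elim ρ id)) ∈ h.getD (i - 1) ∅
  | i, ρ, .and a b => SG.sat h i ρ a ∧ SG.sat h i ρ b
  | i, ρ, .galw a => ∀ j, 1 ≤ j → j ≤ i → SG.sat h j ρ a
  | i, ρ, .fsome a => ∃ j, 1 ≤ j ∧ j ≤ i ∧ SG.sat h j ρ a

/-- Semantics of positive guards. -/
def PG.sat {C : Type} (h : History C) : ℕ → (ℕ → C) → PG C → Prop
  | i, ρ, .simple g => SG.sat h i ρ g
  | i, ρ, .and a b => PG.sat h i ρ a ∧ PG.sat h i ρ b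
  | i, ρ, .or a b => PG.sat h i ρ a ∨ PG.sat h i ρ b
  | i, ρ, .galw a => ∀ j, 1 ≤ j → j ≤ i → PG.sat h j ρ a
  | i, ρ, .fsome a => ∃ j, 1 ≤ j ∧ j ≤ i ∧ PG.sat h j ρ a
  | i, ρ, .since a b =>
      ∃ j, 1 ≤ j ∧ j ≤ i ∧ PG.sat h j ρ b ∧ ∀ k, j < k → k ≤ i → PG.sat h k ρ a

/-- Variables of a simple guard. -/
def SG.vars {C : Type} : SG C → List ℕ
  | .atom _ args => args.filterMap (Sum.elim some fun _ => none)
  | .and a b => a.vars ++ b.vars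
  | .galw a => a.vars
  | .fsome a => a.vars

/-- `G` is a positive guard over the variables `xs`: every constituent simple guard has
exactly the variables `xs` (as a set). -/
def PG.Over {C : Type} (xs : List ℕ) : PG C → Prop
  | .simple g => ∀ x, x ∈ g.vars ↔ x ∈ xs
  | .and a b => PG.Over xs a ∧ PG.Over xs b
  | .or a b => PG.Over xs a ∧ PG.Over xs b
  | .galw a => PG.Over xs a
  | .fsome a => PG.Over xs a
  | .since a b => PG.Over xs a ∧ PG.Over xs b

/-- Formulas of PTLTL^FO+: PTLTL^FO extended with universal and existential
quantifiers guarded by positive guards. -/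
inductive FmP (C : Type) : Type where
  | atom : ℕ → List (Tm C) → FmP C
  | rel : ℕ → List (Tm C) → FmP C
  | and : FmP C → FmP C → FmP C
  | not : FmP C → FmP C
  | prev : FmP C → FmP C
  | since : FmP C → FmP C → FmP C
  | all : List ℕ → ℕ → FmP C → FmP C
  | allG : List ℕ → PG C → FmP C → FmP C
  | exG : List ℕ → PG C → FmP C → FmP C

/-- The forcing relation for PTLTL^FO+. -/
def SatP {C : Type} (F : ℕ → List C → C) (R : ℕ → List C → Bool) (h : History C) :
    ℕ → (ℕ → C) → FmP C → Prop
  | i, ρ, .atom p ts => (p, ts.map (Tm.eval F ρ)) ∈ h.getD (i - 1) ∅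
  | i, ρ, .rel r ts => R r (ts.map (Tm.eval F ρ)) = true
  | i, ρ, .and a b => SatP F R h i ρ a ∧ SatP F R h i ρ b
  | i, ρ, .not a => ¬ SatP F R h i ρ a
  | i, ρ, .prev a => 1 < i ∧ SatP F R h (i - 1) ρ a
  | i, ρ, .since a b =>
      ∃ j, 1 ≤ j ∧ j ≤ i ∧ SatP F R h j ρ b ∧ ∀ k, j < k → k ≤ i → SatP F R h k ρ a
  | i, ρ, .all xs p a =>
      ∀ cs : List C, cs.length = xs.length → (p, cs) ∈ h.getD (i - 1) ∅ →
        SatP F R h i (updEnv ρ xs cs) a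
  | i, ρ, .allG xs G a =>
      ∀ cs : List C, cs.length = xs.length → PG.sat h i (updEnv ρ xs cs) G →
        SatP F R h i (updEnv ρ xs cs) a
  | i, ρ, .exG xs G a =>
      ∃ cs : List C, cs.length = xs.length ∧ PG.sat h i (updEnv ρ xs cs) G ∧
        SatP F R h i (updEnv ρ xs cs) a

/-- Variables of a positive guard. -/
def PG.vars {C : Type} : PG C → List ℕ
  | .simple g => g.vars
  | .and a b => a.vars ++ b.vars
  | .or a b => a.vars ++ b.vars
  | .galw a => a.vars
  | .fsome a => a.vars
  | .since a b => a.vars ++ b.vars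

/-- Free variables of a PTLTL^FO+ formula. -/
def FmP.fv {C : Type} : FmP C → List ℕ
  | .atom _ ts => ts.flatMap Tm.fv
  | .rel _ ts => ts.flatMap Tm.fv
  | .and a b => a.fv ++ b.fv
  | .not a => a.fv
  | .prev a => a.fv
  | .since a b => a.fv ++ b.fv
  | .all xs _ a => a.fv.filter (fun v => v ∉ xs)
  | .allG xs G a => (PG.vars G ++ a.fv).filter (fun v => v ∉ xs)
  | .exG xs G a => (PG.vars G ++ a.fv).filter (fun v => v ∉ xs)

/-- A formula is closed if it has no free variables. -/
def FmP.Closed {C : Type} (φ : FmP C) : Prop := φ.fv = []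

/-- Well-formedness: every guard of a quantifier is a positive guard over exactly the
variables bound by that quantifier (a duplicate-free list). -/
def FmP.WFm {C : Type} : FmP C → Prop
  | .atom _ _ => True
  | .rel _ _ => True
  | .and a b => a.WFm ∧ b.WFm
  | .not a => a.WFm
  | .prev a => a.WFm
  | .since a b => a.WFm ∧ b.WFm
  | .all _ _ a => a.WFm
  | .allG xs G a => xs.Nodup ∧ PG.Over xs G ∧ a.WFm
  | .exG xs G a => xs.Nodup ∧ PG.Over xs G ∧ a.WFm

/-- A natural-number encoding of terms. -/
def Tm.enc {C : Type} [Encodable C] : Tm C → ℕ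
  | .var x => Nat.pair 0 x
  | .const c => Nat.pair 1 (Encodable.encode c)
  | .func f args =>
      Nat.pair 2 (Nat.pair f (Encodable.encode (args.attach.map fun t => Tm.enc t.1)))
  decreasing_by simp_wf; have := List.sizeOf_lt_of_mem t.2; omega

/-- A natural-number encoding of simple guards. -/
def SG.enc {C : Type} [Encodable C] : SG C → ℕ
  | .atom p args => Nat.pair 0 (Nat.pair p (Encodable.encode args))
  | .and a b => Nat.pair 1 (Nat.pair a.enc b.enc)
  | .galw a => Nat.pair 2 a.enc
  | .fsome a => Nat.pair 3 a.enc

/-- A natural-number encoding of positive guards. -/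
def PG.enc {C : Type} [Encodable C] : PG C → ℕ
  | .simple g => Nat.pair 0 g.enc
  | .and a b => Nat.pair 1 (Nat.pair a.enc b.enc)
  | .or a b => Nat.pair 2 (Nat.pair a.enc b.enc)
  | .galw a => Nat.pair 3 a.enc
  | .fsome a => Nat.pair 4 a.enc
  | .since a b => Nat.pair 5 (Nat.pair a.enc b.enc)

/-- A natural-number encoding of PTLTL^FO+ formulas. -/
def FmP.enc {C : Type} [Encodable C] : FmP C → ℕ
  | .atom p ts => Nat.pair 0 (Nat.pair p (Encodable.encode (ts.map Tm.enc)))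
  | .rel r ts => Nat.pair 1 (Nat.pair r (Encodable.encode (ts.map Tm.enc)))
  | .and a b => Nat.pair 2 (Nat.pair a.enc b.enc)
  | .not a => Nat.pair 3 a.enc
  | .prev a => Nat.pair 4 a.enc
  | .since a b => Nat.pair 5 (Nat.pair a.enc b.enc)
  | .all xs p a => Nat.pair 6 (Nat.pair (Encodable.encode xs) (Nat.pair p a.enc))
  | .allG xs G a => Nat.pair 7 (Nat.pair (Encodable.encode xs) (Nat.pair G.enc a.enc))
  | .exG xs G a => Nat.pair 8 (Nat.pair (Encodable.encode xs) (Nat.pair G.enc a.enc))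

attribute [fun_prop] Computable

namespace MC
set_option linter.unusedSectionVars false
variable {α β γ σ : Type} [Primcodable α] [Primcodable β] [Primcodable γ] [Primcodable σ]

@[fun_prop] theorem cid : Computable (fun a : α => a) := Computable.id
@[fun_prop] theorem cconst (b : β) : Computable (fun _ : α => b) := Computable.const b
@[fun_prop] theorem ccomp {f : β → σ} {g : α → β} (hf : Computable f) (hg : Computable g) :
    Computable (fun a => f (g a)) := hf.comp hg
@[fun_prop] theorem cpair {f : α → β} {g : α → γ} (hf : Computable f) (hg : Computable g) :
    Computable (fun a => (f a, g a)) := hf.pair hg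
@[fun_prop] theorem cfst {f : α → β × γ} (hf : Computable f) :
    Computable (fun a => (f a).1) := Computable.fst.comp hf
@[fun_prop] theorem csnd {f : α → β × γ} (hf : Computable f) :
    Computable (fun a => (f a).2) := Computable.snd.comp hf
@[fun_prop] theorem ccond {c : α → Bool} {f g : α → β} (hc : Computable c) (hf : Computable f)
    (hg : Computable g) : Computable (fun a => bif c a then f a else g a) := hc.cond hf hg
@[fun_prop] theorem csome {f : α → β} (hf : Computable f) :
    Computable (fun a => some (f a)) := Computable.option_some.comp hf
@[fun_prop] theorem cgetD {f : α → Option β} {g : α → β} (hf : Computable f) (hg : Computable g) :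
    Computable (fun a => (f a).getD (g a)) := Computable.option_getD hf hg
@[fun_prop] theorem ccons {f : α → β} {g : α → List β} (hf : Computable f) (hg : Computable g) :
    Computable (fun a => f a :: g a) := Computable.list_cons.comp hf hg
@[fun_prop] theorem cappend {f g : α → List β} (hf : Computable f) (hg : Computable g) :
    Computable (fun a => f a ++ g a) := Computable.list_append.comp hf hg
@[fun_prop] theorem clength {f : α → List β} (hf : Computable f) :
    Computable (fun a => (f a).length) := Computable.list_length.comp hf
@[fun_prop] theorem cget {f : α → List β} {g : α → ℕ} (hf : Computable f) (hg : Computable g) :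
    Computable (fun a => (f a)[g a]?) := Computable.list_getElem?.comp hf hg
@[fun_prop] theorem ctake {f : α → List β} {g : α → ℕ} (hf : Computable f) (hg : Computable g) :
    Computable (fun a => (f a).take (g a)) := Primrec.list_take.to_comp.comp hg hf
@[fun_prop] theorem cdrop {f : α → List β} {g : α → ℕ} (hf : Computable f) (hg : Computable g) :
    Computable (fun a => (f a).drop (g a)) := Primrec.list_drop.to_comp.comp hg hf
@[fun_prop] theorem crange {f : α → ℕ} (hf : Computable f) :
    Computable (fun a => List.range (f a)) := Primrec.list_range.to_comp.comp hf
@[fun_prop] theorem cunpair {f : α → ℕ} (hf : Computable f) :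
    Computable (fun a => Nat.unpair (f a)) := Computable.unpair.comp hf
@[fun_prop] theorem cadd {f g : α → ℕ} (hf : Computable f) (hg : Computable g) :
    Computable (fun a => f a + g a) := Primrec.nat_add.to_comp.comp hf hg
@[fun_prop] theorem csub {f g : α → ℕ} (hf : Computable f) (hg : Computable g) :
    Computable (fun a => f a - g a) := Primrec.nat_sub.to_comp.comp hf hg
@[fun_prop] theorem cdiv {f g : α → ℕ} (hf : Computable f) (hg : Computable g) :
    Computable (fun a => f a / g a) := Primrec.nat_div.to_comp.comp hf hg
@[fun_prop] theorem cand {f g : α → Bool} (hf : Computable f) (hg : Computable g) :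
    Computable (fun a => f a && g a) := Primrec.and.to_comp.comp hf hg
@[fun_prop] theorem cor {f g : α → Bool} (hf : Computable f) (hg : Computable g) :
    Computable (fun a => f a || g a) := Primrec.or.to_comp.comp hf hg
@[fun_prop] theorem cnot {f : α → Bool} (hf : Computable f) :
    Computable (fun a => !f a) := Primrec.not.to_comp.comp hf
/-- Boolean equality. -/
def eqB [DecidableEq β] (x y : β) : Bool := decide (x = y)
/-- Boolean comparison. -/
def ltB (x y : ℕ) : Bool := decide (x < y)
/-- Boolean membership. -/
def memB [DecidableEq β] (x : β) (l : List β) : Bool := decide (x ∈ l)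
@[simp] theorem eqB_iff [DecidableEq β] (x y : β) : eqB x y = true ↔ x = y := by simp [eqB]
@[simp] theorem ltB_iff (x y : ℕ) : ltB x y = true ↔ x < y := by simp [ltB]
@[simp] theorem memB_iff [DecidableEq β] (x : β) (l : List β) : memB x l = true ↔ x ∈ l := by
  simp [memB]
@[fun_prop] theorem ceq [DecidableEq β] {f g : α → β} (hf : Computable f) (hg : Computable g) :
    Computable (fun a => eqB (f a) (g a)) := by
  have : Primrec (fun p : β × β => decide (p.1 = p.2)) := (Primrec.eq (α := β)).decide
  exact this.to_comp.comp (hf.pair hg)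
@[fun_prop] theorem clt {f g : α → ℕ} (hf : Computable f) (hg : Computable g) :
    Computable (fun a => ltB (f a) (g a)) := by
  have : Primrec (fun p : ℕ × ℕ => decide (p.1 < p.2)) := (Primrec.nat_lt).decide
  exact this.to_comp.comp (hf.pair hg)
@[fun_prop] theorem cdecode {f : α → ℕ} (hf : Computable f) :
    Computable (fun a => (Encodable.decode (f a) : Option β)) := Computable.decode.comp hf
@[fun_prop] theorem cnatrec {f : α → ℕ} {g : α → σ} {h : α → ℕ → σ → σ} (hf : Computable f)
    (hg : Computable g) (hh : Computable fun p : α × (ℕ × σ) => h p.1 p.2.1 p.2.2) :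
    Computable fun a => Nat.rec (motive := fun _ => σ) (g a) (h a) (f a) :=
  Computable.nat_rec (h := fun a p => h a p.1 p.2) hf hg hh
@[fun_prop] theorem coptcases {o : α → Option β} {f : α → σ} {g : α → β → σ}
    (ho : Computable o) (hf : Computable f) (hg : Computable fun p : α × β => g p.1 p.2) :
    Computable fun a => (o a).elim (f a) (g a) :=
  (Computable.option_casesOn ho hf hg).of_eq fun a => by cases o a <;> rfl
@[fun_prop] theorem csumelim {o : α → β ⊕ γ} {f : α → β → σ} {g : α → γ → σ}
    (ho : Computable o) (hf : Computable fun p : α × β => f p.1 p.2)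
    (hg : Computable fun p : α × γ => g p.1 p.2) :
    Computable fun a => Sum.elim (f a) (g a) (o a) :=
  (Computable.sumCasesOn ho hf hg).of_eq fun a => by cases o a <;> rfl

theorem foldl_rec (f : σ → β → σ) (s : σ) (l : List β) (n : ℕ) :
    Nat.rec (motive := fun _ => σ) s (fun k acc => (l[k]?).elim acc (fun b => f acc b)) n
      = (l.take n).foldl f s := by
  induction n with
  | zero => simp
  | succ n ih =>
    simp only [ih]
    rw [List.take_add_one]
    cases h : l[n]? <;> simp

@[fun_prop] theorem cfoldl {l : α → List β} {s : α → σ} {f : α → σ → β → σ} (hl : Computable l)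
    (hs : Computable s) (hf : Computable fun p : α × (σ × β) => f p.1 p.2.1 p.2.2) :
    Computable fun a => (l a).foldl (f a) (s a) := by
  have : Computable fun a => Nat.rec (motive := fun _ => σ) (s a)
    (fun k acc => ((l a)[k]?).elim acc (fun b => f a acc b)) (l a).length := by
    apply cnatrec
    · fun_prop
    · fun_prop
    · apply coptcases
      · fun_prop
      · fun_prop
      · exact hf.comp (f := fun p : α × (σ × β) => f p.1 p.2.1 p.2.2)
          (g := fun p : (α × (ℕ × σ)) × β => (p.1.1, (p.1.2.2, p.2))) (by fun_prop)
  refine this.of_eq fun a => ?_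
  rw [foldl_rec, List.take_length]

theorem foldl_map (g : β → γ) (l : List β) (acc : List γ) :
    l.foldl (fun acc b => acc ++ [g b]) acc = acc ++ l.map g := by
  induction l generalizing acc <;> simp_all
theorem foldl_flatMap (g : β → List γ) (l : List β) (acc : List γ) :
    l.foldl (fun acc b => acc ++ g b) acc = acc ++ l.flatMap g := by
  induction l generalizing acc <;> simp_all
theorem foldl_filter (g : β → Bool) (l : List β) (acc : List β) :
    l.foldl (fun acc b => acc ++ bif g b then [b] else []) acc = acc ++ l.filter g := by
  induction l generalizing acc with
  | nil => simp
  | cons b l ih => simp only [List.foldl_cons, ih, List.filter_cons]; cases g b <;> simp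
theorem foldl_all (g : β → Bool) (l : List β) (acc : Bool) :
    l.foldl (fun acc b => acc && g b) acc = (acc && l.all g) := by
  induction l generalizing acc with
  | nil => simp
  | cons b l ih => rw [List.foldl_cons, ih, List.all_cons, Bool.and_assoc]
theorem foldl_any (g : β → Bool) (l : List β) (acc : Bool) :
    l.foldl (fun acc b => acc || g b) acc = (acc || l.any g) := by
  induction l generalizing acc with
  | nil => simp
  | cons b l ih => rw [List.foldl_cons, ih, List.any_cons, Bool.or_assoc]

@[fun_prop] theorem cmap {l : α → List β} {f : α → β → γ} (hl : Computable l)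
    (hf : Computable fun p : α × β => f p.1 p.2) :
    Computable fun a => (l a).map (f a) := by
  have : Computable fun a => (l a).foldl (fun acc b => acc ++ [f a b]) [] := by
    apply cfoldl
    · fun_prop
    · fun_prop
    · have := hf.comp (f := fun p : α × β => f p.1 p.2)
          (g := fun p : α × (List γ × β) => (p.1, p.2.2)) (by fun_prop)
      fun_prop
  exact this.of_eq fun a => by rw [foldl_map, List.nil_append]
@[fun_prop] theorem cflatMap {l : α → List β} {f : α → β → List γ} (hl : Computable l)
    (hf : Computable fun p : α × β => f p.1 p.2) :
    Computable fun a => (l a).flatMap (f a) := by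
  have : Computable fun a => (l a).foldl (fun acc b => acc ++ f a b) [] := by
    apply cfoldl
    · fun_prop
    · fun_prop
    · have := hf.comp (f := fun p : α × β => f p.1 p.2)
          (g := fun p : α × (List γ × β) => (p.1, p.2.2)) (by fun_prop)
      fun_prop
  exact this.of_eq fun a => by rw [foldl_flatMap, List.nil_append]
@[fun_prop] theorem cfilter {l : α → List β} {f : α → β → Bool} (hl : Computable l)
    (hf : Computable fun p : α × β => f p.1 p.2) :
    Computable fun a => (l a).filter (f a) := by
  have : Computable fun a => (l a).foldl (fun acc b => acc ++ bif f a b then [b] else []) [] := by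
    apply cfoldl
    · fun_prop
    · fun_prop
    · have := hf.comp (f := fun p : α × β => f p.1 p.2)
          (g := fun p : α × (List β × β) => (p.1, p.2.2)) (by fun_prop)
      fun_prop
  exact this.of_eq fun a => by rw [foldl_filter, List.nil_append]
@[fun_prop] theorem call {l : α → List β} {f : α → β → Bool} (hl : Computable l)
    (hf : Computable fun p : α × β => f p.1 p.2) :
    Computable fun a => (l a).all (f a) := by
  have : Computable fun a => (l a).foldl (fun acc b => acc && f a b) true := by
    apply cfoldl
    · fun_prop
    · fun_prop
    · have := hf.comp (f := fun p : α × β => f p.1 p.2)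
          (g := fun p : α × (Bool × β) => (p.1, p.2.2)) (by fun_prop)
      fun_prop
  exact this.of_eq fun a => by simp [foldl_all]
@[fun_prop] theorem cany {l : α → List β} {f : α → β → Bool} (hl : Computable l)
    (hf : Computable fun p : α × β => f p.1 p.2) :
    Computable fun a => (l a).any (f a) := by
  have : Computable fun a => (l a).foldl (fun acc b => acc || f a b) false := by
    apply cfoldl
    · fun_prop
    · fun_prop
    · have := hf.comp (f := fun p : α × β => f p.1 p.2)
          (g := fun p : α × (Bool × β) => (p.1, p.2.2)) (by fun_prop)
      fun_prop
  exact this.of_eq fun a => by simp [foldl_any]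

@[fun_prop] theorem cmem [DecidableEq β] {l : α → List β} {f : α → β} (hl : Computable l)
    (hf : Computable f) : Computable fun a => memB (f a) (l a) := by
  have : Computable fun a => (l a).any (fun b => eqB b (f a)) := by fun_prop
  exact this.of_eq fun a => by rw [Bool.eq_iff_iff]; simp


theorem zip_eq (m : List γ) (l : List β) : (List.range l.length).flatMap
    (fun k => (l[k]?).elim [] (fun b => (m[k]?).elim [] (fun x => [(b, x)]))) = l.zip m := by
  induction l generalizing m with
  | nil => simp
  | cons b l ih =>
    cases m with
    | nil =>
      simp
      intro x _
      cases (b :: l)[x]? <;> rfl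
    | cons x m =>
      simp [List.range_succ_eq_map, List.flatMap_map, ← ih m]

@[fun_prop] theorem czip {l : α → List β} {m : α → List γ} (hl : Computable l)
    (hm : Computable m) : Computable fun a => (l a).zip (m a) := by
  have : Computable fun a => (List.range (l a).length).flatMap
    (fun k => ((l a)[k]?).elim [] (fun b => ((m a)[k]?).elim [] (fun x => [(b, x)]))) := by
    fun_prop
  exact this.of_eq fun a => by rw [zip_eq]

/-- General fuelled tree recursion. -/
def fuelRec (ex : α → List α) (cb : α → List β → β) (d : β) : ℕ → α → β
  | 0, _ => d
  | k + 1, q => cb q ((ex q).map (fuelRec ex cb d k))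

/-- The level of queries at depth `k`. -/
def level (ex : α → List α) (q : α) (k : ℕ) : List α :=
  Nat.rec (motive := fun _ => List α) [q] (fun _ l => l.flatMap ex) k

/-- Combine the values for the children of the queries `qs`. -/
def chunk (ex : α → List α) (cb : α → List β → β) (qs : List α) (vs : List β) : List β :=
  (qs.foldl (fun (s : List β × List β) q =>
    (s.1 ++ [cb q (s.2.take (ex q).length)], s.2.drop (ex q).length)) ([], vs)).1

theorem chunk_aux (ex : α → List α) (cb : α → List β → β) (e : α → β) (qs : List α)
    (acc rest : List β) :
    qs.foldl (fun (s : List β × List β) q =>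
    (s.1 ++ [cb q (s.2.take (ex q).length)], s.2.drop (ex q).length))
      (acc, (qs.flatMap ex).map e ++ rest)
      = (acc ++ qs.map (fun q => cb q ((ex q).map e)), rest) := by
  induction qs generalizing acc with
  | nil => simp
  | cons q qs ih =>
    have h1 : (((q :: qs).flatMap ex).map e ++ rest).take (ex q).length = (ex q).map e := by
      rw [List.flatMap_cons, List.map_append, List.append_assoc]
      exact List.take_left' (by simp)
    have h2 : (((q :: qs).flatMap ex).map e ++ rest).drop (ex q).length
        = (qs.flatMap ex).map e ++ rest := by
      rw [List.flatMap_cons, List.map_append, List.append_assoc]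
      exact List.drop_left' (by simp)
    rw [List.foldl_cons, h1, h2, ih]
    simp

theorem chunk_eq (ex : α → List α) (cb : α → List β → β) (e : α → β) (qs : List α) :
    chunk ex cb qs ((qs.flatMap ex).map e) = qs.map (fun q => cb q ((ex q).map e)) := by
  have := chunk_aux ex cb e qs [] []
  rw [List.append_nil] at this
  rw [chunk, this]; simp

theorem clevel {ex : α → List α} (hex : Computable ex) {f : γ → α} {k : γ → ℕ}
    (hf : Computable f) (hk : Computable k) : Computable fun a => level ex (f a) (k a) := by
  unfold level; fun_prop

theorem cchunk {ex : α → List α} {cb : α → List β → β} (hex : Computable ex)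
    (hcb : Computable fun p : α × List β => cb p.1 p.2) {f : γ → List α} {k : γ → List β}
    (hf : Computable f) (hk : Computable k) : Computable fun a => chunk ex cb (f a) (k a) := by
  unfold chunk
  have : Computable fun p : γ × ((List β × List β) × α) =>
      cb p.2.2 (p.2.1.2.take (ex p.2.2).length) :=
    hcb.comp (g := fun p : γ × ((List β × List β) × α) =>
      (p.2.2, p.2.1.2.take (ex p.2.2).length)) (by fun_prop)
  fun_prop

/-- Values at the levels, bottom up. -/
def bottomUp (ex : α → List α) (cb : α → List β → β) (d : β) (N : ℕ) (q : α) (j : ℕ) : List β :=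
  Nat.rec (motive := fun _ => List β) ((level ex q N).map (fun _ => d))
    (fun j vs => chunk ex cb (level ex q (N - (j + 1))) vs) j

theorem bottomUp_eq (ex : α → List α) (cb : α → List β → β) (d : β) (N : ℕ) (q : α) (j : ℕ)
    (hj : j ≤ N) : bottomUp ex cb d N q j = (level ex q (N - j)).map (fuelRec ex cb d j) := by
  induction j with
  | zero => simp [bottomUp, fuelRec]
  | succ j ih =>
    have h1 : level ex q (N - j) = (level ex q (N - (j + 1))).flatMap ex := by
      have : N - j = (N - (j + 1)) + 1 := by omega
      rw [this]; rfl
    change chunk ex cb (level ex q (N - (j + 1))) (bottomUp ex cb d N q j) = _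
    rw [ih (by omega), h1, chunk_eq]
    rfl

theorem cfuelRec {ex : α → List α} {cb : α → List β → β} (d : β) (hex : Computable ex)
    (hcb : Computable fun p : α × List β => cb p.1 p.2) {n : γ → ℕ} {f : γ → α}
    (hn : Computable n) (hf : Computable f) :
    Computable fun a => fuelRec ex cb d (n a) (f a) := by
  have : Computable fun a => ((bottomUp ex cb d (n a) (f a) (n a))[0]?).getD d := by
    unfold bottomUp
    have h1 := clevel hex hf hn
    have h2 : Computable fun p : γ × ℕ × List β =>
        level ex (f p.1) (n p.1 - (p.2.1 + 1)) := clevel hex (by fun_prop) (by fun_prop)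
    have h3 := cchunk hex hcb h2 (k := fun p : γ × ℕ × List β => p.2.2) (by fun_prop)
    fun_prop
  exact this.of_eq fun a => by rw [bottomUp_eq _ _ _ _ _ _ le_rfl]; simp [level]

theorem lt_pair {t n : ℕ} (ht : 1 ≤ t) : n < Nat.pair t n := by
  unfold Nat.pair; split_ifs <;> nlinarith

theorem mem_lt_encode {l : List ℕ} {n : ℕ} (hn : n ∈ l) : n < Encodable.encode l := by
  induction l with
  | nil => simp at hn
  | cons a l ih =>
    rw [Encodable.encode_list_cons]
    rcases List.mem_cons.1 hn with rfl | h
    · exact Nat.lt_succ_of_le (Nat.left_le_pair _ _)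
    · exact Nat.lt_succ_of_le ((ih h).le.trans (Nat.right_le_pair _ _))

section env
variable {C : Type} [Primcodable C] [DecidableEq C]

/-- Environment given by an association list, with default value. -/
def envVal (c0 : C) (e : List (ℕ × C)) (v : ℕ) : C :=
  (((e.filter fun p => eqB (p.1) (v)).map Prod.snd)[0]?).getD c0

@[fun_prop] theorem cenvVal (c0 : C) {f : α → List (ℕ × C)} {v : α → ℕ} (hf : Computable f)
    (hv : Computable v) : Computable fun a => envVal c0 (f a) (v a) := by
  unfold envVal; fun_prop

theorem envVal_eq (c0 : C) (e : List (ℕ × C)) (v : ℕ) : envVal c0 e v = (e.lookup v).getD c0 := by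
  unfold envVal
  congr 1
  induction e with
  | nil => simp
  | cons p e ih =>
    rw [List.lookup_cons, List.filter_cons]
    unfold eqB at ih ⊢
    by_cases h : p.1 = v
    · simp [h]
    · have h' : (v == p.1) = false := by simpa using fun h' => h h'.symm
      simp only [h, h', decide_false, Bool.false_eq_true, if_false]
      exact ih

theorem lookup_append {l m : List (ℕ × C)} {v : ℕ} :
    (l ++ m).lookup v = (l.lookup v).or (m.lookup v) := by
  induction l with
  | nil => simp
  | cons p l ih =>
    rw [List.cons_append, List.lookup_cons, List.lookup_cons]
    cases v == p.1 <;> simp [ih]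

theorem envVal_upd (c0 : C) (e : List (ℕ × C)) (xs : List ℕ) (cs : List C) :
    envVal c0 (xs.zip cs ++ e) = updEnv (envVal c0 e) xs cs := by
  funext v
  rw [envVal_eq, lookup_append, updEnv, envVal_eq]
  cases (xs.zip cs).lookup v <;> simp

/-! Terms -/

/-- Subterm queries. -/
def tmEx (q : List (ℕ × C) × ℕ) : List (List (ℕ × C) × ℕ) :=
  bif eqB (q.2.unpair.1) (2) then
    (((Encodable.decode q.2.unpair.2.unpair.2 : Option (List ℕ)).getD []).map fun n => (q.1, n))
  else []

/-- Term value from subterm values. -/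
def tmCb (F : ℕ → List C → C) (c0 : C) (q : List (ℕ × C) × ℕ) (vs : List C) : C :=
  bif eqB (q.2.unpair.1) (0) then envVal c0 q.1 q.2.unpair.2
  else bif eqB (q.2.unpair.1) (1) then (Encodable.decode q.2.unpair.2 : Option C).getD c0
  else F q.2.unpair.2.unpair.1 vs

/-- Evaluation of a term code. -/
def tmEval (F : ℕ → List C → C) (c0 : C) (e : List (ℕ × C)) (n : ℕ) : C :=
  fuelRec tmEx (tmCb F c0) c0 (n + 1) (e, n)

theorem ctmEval {F : ℕ → List C → C} (hF : Computable fun q : ℕ × List C => F q.1 q.2) (c0 : C)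
    {f : α → List (ℕ × C)} {v : α → ℕ} (hf : Computable f)
    (hv : Computable v) : Computable fun a => tmEval F c0 (f a) (v a) := by
  unfold tmEval
  apply cfuelRec
  · unfold tmEx; fun_prop
  · unfold tmCb
    have : Computable fun p : (List (ℕ × C) × ℕ) × List C =>
      F p.1.2.unpair.2.unpair.1 p.2 := hF.comp (g := fun p : (List (ℕ × C) × ℕ) × List C =>
        (p.1.2.unpair.2.unpair.1, p.2)) (by fun_prop)
    fun_prop
  · fun_prop
  · fun_prop

theorem tm_correct (F : ℕ → List C → C) (c0 : C) (e : List (ℕ × C)) :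
    ∀ (t : Tm C) (k : ℕ), t.enc < k →
      fuelRec tmEx (tmCb F c0) c0 k (e, t.enc) = t.eval F (envVal c0 e)
  | .var x, k, hk => by
    obtain ⟨k, rfl⟩ := Nat.exists_eq_succ_of_ne_zero (Nat.ne_zero_of_lt hk)
    simp [fuelRec, tmCb, eqB, Tm.enc, Tm.eval]
  | .const c, k, hk => by
    obtain ⟨k, rfl⟩ := Nat.exists_eq_succ_of_ne_zero (Nat.ne_zero_of_lt hk)
    simp [fuelRec, tmCb, eqB, Tm.enc, Tm.eval]
  | .func f args, k, hk => by
    obtain ⟨k, rfl⟩ := Nat.exists_eq_succ_of_ne_zero (Nat.ne_zero_of_lt hk)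
    have ih : ∀ t ∈ args, fuelRec tmEx (tmCb F c0) c0 k (e, t.enc) = t.eval F (envVal c0 e) := by
      intro t ht
      apply tm_correct F c0 e t k
      have h1 : t.enc < Encodable.encode (args.attach.map fun t => Tm.enc t.1) :=
        mem_lt_encode (List.mem_map.2 ⟨⟨t, ht⟩, List.mem_attach _ _, rfl⟩)
      rw [Tm.enc] at hk
      have h2 := Nat.right_le_pair f (Encodable.encode (args.attach.map fun t => Tm.enc t.1))
      have h3 := Nat.right_le_pair 2
        (Nat.pair f (Encodable.encode (args.attach.map fun t => Tm.enc t.1)))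
      omega
    have h1 : tmEx (e, (Tm.func f args).enc) = args.map (fun t => (e, t.enc)) := by
      simp [tmEx, eqB, Tm.enc, Function.comp_def]
    have h2 : ∀ vs, tmCb F c0 (e, (Tm.func f args).enc) vs = F f vs := by
      intro vs; simp [tmCb, eqB, Tm.enc]
    rw [fuelRec, h1, h2, Tm.eval, List.map_map]
    congr 1
    rw [show args.attach.map (fun t => Tm.eval F (envVal c0 e) t.1)
      = args.map (Tm.eval F (envVal c0 e)) by simp]
    exact List.map_congr_left fun t ht => ih t ht
  termination_by t => sizeOf t
  decreasing_by simp_wf; have := List.sizeOf_lt_of_mem ht; omega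

theorem tmEval_eq (F : ℕ → List C → C) (c0 : C) (e : List (ℕ × C)) (t : Tm C) :
    tmEval F c0 e t.enc = t.eval F (envVal c0 e) := tm_correct F c0 e t _ (Nat.lt_succ_self _)

/-! Boolean evaluation -/

/-- Boolean combination modes: all, any, not all, since. -/
def comb (m : ℕ) (vs : List Bool) : Bool :=
  bif eqB (m) (0) then vs.all fun b => b
  else bif eqB (m) (1) then vs.any fun b => b
  else bif eqB (m) (2) then !(vs.all fun b => b)
  else (List.range (vs.length / 2)).foldl
    (fun acc j => (vs[j]?).getD false || ((vs[vs.length / 2 + j]?).getD false && acc)) false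

@[fun_prop] theorem ccomb {m : α → ℕ} {vs : α → List Bool} (hm : Computable m)
    (hv : Computable vs) : Computable fun a => comb (m a) (vs a) := by
  unfold comb; fun_prop

/-- Boolean tree evaluation with fuel. -/
def bev (step : α → ℕ × List α) (k : ℕ) (q : α) : Bool :=
  fuelRec (fun q => (step q).2) (fun q vs => comb (step q).1 vs) false k q

theorem cbev {step : α → ℕ × List α} (hs : Computable step) {k : γ → ℕ} {q : γ → α}
    (hk : Computable k) (hq : Computable q) : Computable fun a => bev step (k a) (q a) := by
  unfold bev
  apply cfuelRec <;> fun_prop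

theorem bev_succ (step : α → ℕ × List α) (k : ℕ) (q : α) :
    bev step (k + 1) q = comb (step q).1 ((step q).2.map (bev step k)) := rfl

theorem bev_all {step : α → ℕ × List α} {k : ℕ} {q : α} {l : List α} (h : step q = (0, l)) :
    bev step (k + 1) q = true ↔ ∀ q' ∈ l, bev step k q' = true := by
  rw [bev_succ, h]; simp [comb, eqB]

theorem bev_any {step : α → ℕ × List α} {k : ℕ} {q : α} {l : List α} (h : step q = (1, l)) :
    bev step (k + 1) q = true ↔ ∃ q' ∈ l, bev step k q' = true := by
  rw [bev_succ, h]; simp [comb, eqB]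

theorem bev_not {step : α → ℕ × List α} {k : ℕ} {q q' : α} (h : step q = (2, [q'])) :
    bev step (k + 1) q = true ↔ ¬ bev step k q' = true := by
  rw [bev_succ, h]; simp [comb, eqB]

theorem bev_leaf {step : α → ℕ × List α} {k : ℕ} {q : α} {b : Bool}
    (h : step q = (bif b then 0 else 1, [])) :
    bev step (k + 1) q = true ↔ b = true := by
  rw [bev_succ, h]; cases b <;> simp [comb, eqB]

theorem since_fold (A B : ℕ → Bool) (n : ℕ) :
    (List.range n).foldl (fun acc j => B j || (A j && acc)) false = true ↔
      ∃ j, j < n ∧ B j = true ∧ ∀ k, j < k → k < n → A k = true := by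
  induction n with
  | zero => simp
  | succ n ih =>
    rw [List.range_succ, List.foldl_append, List.foldl_cons, List.foldl_nil, Bool.or_eq_true,
      Bool.and_eq_true, ih]
    constructor
    · rintro (h | ⟨h, j, hj, hB, hA⟩)
      · exact ⟨n, Nat.lt_succ_self _, h, fun k h1 h2 => by omega⟩
      · refine ⟨j, by omega, hB, fun k h1 h2 => ?_⟩
        rcases Nat.lt_succ_iff_lt_or_eq.1 h2 with h3 | rfl
        · exact hA k h1 h3
        · exact h
    · rintro ⟨j, hj, hB, hA⟩
      rcases Nat.lt_succ_iff_lt_or_eq.1 hj with h3 | rfl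
      · exact Or.inr ⟨hA n h3 (Nat.lt_succ_self _), j, h3, hB, fun k h1 h2 => hA k h1 (by omega)⟩
      · exact Or.inl hB

theorem foldl_congr_mem {f g : Bool → ℕ → Bool} {l : List ℕ} {s : Bool}
    (h : ∀ b, ∀ x ∈ l, f b x = g b x) : l.foldl f s = l.foldl g s := by
  induction l generalizing s with
  | nil => rfl
  | cons a l ih =>
    rw [List.foldl_cons, List.foldl_cons, h s a (by simp)]
    exact ih fun b x hx => h b x (by simp [hx])

theorem bev_since {step : α → ℕ × List α} {k : ℕ} {q : α} {i : ℕ} {A B : ℕ → α}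
    (h : step q = (3, (List.range i).map B ++ (List.range i).map A)) :
    bev step (k + 1) q = true ↔ ∃ j, j < i ∧ bev step k (B j) = true ∧
      ∀ m, j < m → m < i → bev step k (A m) = true := by
  rw [bev_succ, h, ← since_fold (fun m => bev step k (A m)) (fun m => bev step k (B m))]
  have hl : (i + i) / 2 = i := by omega
  simp only [comb, eqB, List.length_map, List.length_append, List.length_range, hl]
  simp only [OfNat.ofNat_ne_zero, OfNat.ofNat_ne_one, decide_false, cond_false,
    show ¬ (3 : ℕ) = 2 by omega]
  rw [foldl_congr_mem]
  intro b x hx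
  have hx := List.mem_range.1 hx
  have h1 : (List.map (bev step k) (List.map B (List.range i) ++ List.map A (List.range i)))[x]?
      = some (bev step k (B x)) := by
    rw [List.map_append, List.getElem?_append_left (by simpa using hx)]; simp [hx]
  have h2 : (List.map (bev step k)
      (List.map B (List.range i) ++ List.map A (List.range i)))[i + x]?
      = some (bev step k (A x)) := by
    rw [List.map_append, List.getElem?_append_right (by simp)]; simp [hx]
  rw [h1, h2]; rfl

/-- Queries: history, index, environment, code. -/
abbrev Qy (C : Type) := List (List (ℕ × List C)) × ℕ × List (ℕ × C) × ℕ

/-- The tag of a query. -/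
def Qy.tag (q : Qy C) : ℕ := q.2.2.2.unpair.1
/-- The argument of a query. -/
def Qy.arg (q : Qy C) : ℕ := q.2.2.2.unpair.2
/-- Same query at another code. -/
def Qy.sub (q : Qy C) (n : ℕ) : Qy C := (q.1, q.2.1, q.2.2.1, n)
/-- Same query at another index and code. -/
def Qy.moved (q : Qy C) (i n : ℕ) : Qy C := (q.1, i, q.2.2.1, n)
/-- Same query with more bindings and another code. -/
def Qy.bind (q : Qy C) (xs : List ℕ) (cs : List C) (n : ℕ) : Qy C :=
  (q.1, q.2.1, xs.zip cs ++ q.2.2.1, n)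
/-- Events of the current session. -/
def Qy.ev (q : Qy C) : List (ℕ × List C) := (q.1[q.2.1 - 1]?).getD []
/-- A leaf answer. -/
def leaf (b : Bool) : ℕ × List (Qy C) := (bif b then 0 else 1, [])

@[fun_prop] theorem ctag {q : α → Qy C} (hq : Computable q) : Computable fun a => (q a).tag := by
  unfold Qy.tag; fun_prop
@[fun_prop] theorem carg {q : α → Qy C} (hq : Computable q) : Computable fun a => (q a).arg := by
  unfold Qy.arg; fun_prop
@[fun_prop] theorem cqsub {q : α → Qy C} {n : α → ℕ} (hq : Computable q) (hn : Computable n) :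
    Computable fun a => (q a).sub (n a) := by
  unfold Qy.sub; fun_prop
@[fun_prop] theorem cmoved {q : α → Qy C} {i n : α → ℕ} (hq : Computable q) (hi : Computable i)
    (hn : Computable n) : Computable fun a => (q a).moved (i a) (n a) := by
  unfold Qy.moved; fun_prop
@[fun_prop] theorem cbind {q : α → Qy C} {xs : α → List ℕ} {cs : α → List C} {n : α → ℕ}
    (hq : Computable q) (hx : Computable xs) (hc : Computable cs)
    (hn : Computable n) : Computable fun a => (q a).bind (xs a) (cs a) (n a) := by
  unfold Qy.bind; fun_prop
@[fun_prop] theorem cev {q : α → Qy C} (hq : Computable q) : Computable fun a => (q a).ev := by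
  unfold Qy.ev; fun_prop
@[fun_prop] theorem cleaf {b : α → Bool} (hb : Computable b) :
    Computable fun a => (leaf (b a) : ℕ × List (Qy C)) := by
  unfold leaf; fun_prop

/-- Queries for all sessions up to now. -/
def Qy.past (q : Qy C) (n : ℕ) : List (Qy C) :=
  (List.range q.2.1).map fun j => q.moved (j + 1) n
@[fun_prop] theorem cpast {q : α → Qy C} {n : α → ℕ} (hq : Computable q)
    (hn : Computable n) : Computable fun a => (q a).past (n a) := by
  unfold Qy.past; fun_prop

/-- Step function for simple guards. -/
def sgStep (c0 : C) (q : Qy C) : ℕ × List (Qy C) :=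
  bif eqB (q.tag) (0) then
    leaf (memB (q.arg.unpair.1,
      ((Encodable.decode q.arg.unpair.2 : Option (List (ℕ ⊕ C))).getD []).map
        fun s => Sum.elim (fun v => envVal c0 q.2.2.1 v) (fun c => c) s) q.ev)
  else bif eqB (q.tag) (1) then (0, [q.sub q.arg.unpair.1, q.sub q.arg.unpair.2])
  else bif eqB (q.tag) (2) then (0, q.past q.arg)
  else (1, q.past q.arg)

@[fun_prop] theorem csgStep (c0 : C) : Computable (sgStep c0) := by
  unfold sgStep; fun_prop

/-- Evaluation of simple guards. -/
def sgEval (c0 : C) (q : Qy C) : Bool := bev (sgStep c0) (q.2.2.2 + 1) q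
@[fun_prop] theorem csgEval (c0 : C) : Computable (sgEval c0) := by
  unfold sgEval; apply cbev <;> fun_prop

/-- Step function for positive guards. -/
def pgStep (c0 : C) (q : Qy C) : ℕ × List (Qy C) :=
  bif eqB (q.tag) (0) then leaf (sgEval c0 (q.sub q.arg))
  else bif eqB (q.tag) (1) then (0, [q.sub q.arg.unpair.1, q.sub q.arg.unpair.2])
  else bif eqB (q.tag) (2) then (1, [q.sub q.arg.unpair.1, q.sub q.arg.unpair.2])
  else bif eqB (q.tag) (3) then (0, q.past q.arg)
  else bif eqB (q.tag) (4) then (1, q.past q.arg)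
  else (3, q.past q.arg.unpair.2 ++ q.past q.arg.unpair.1)

@[fun_prop] theorem cpgStep (c0 : C) : Computable (pgStep c0) := by
  unfold pgStep; fun_prop

/-- Evaluation of positive guards. -/
def pgEval (c0 : C) (q : Qy C) : Bool := bev (pgStep c0) (q.2.2.2 + 1) q
@[fun_prop] theorem cpgEval (c0 : C) : Computable (pgEval c0) := by
  unfold pgEval; apply cbev <;> fun_prop

/-- All tuples of length `n` over `D`. -/
def tuples (D : List C) (n : ℕ) : List (List C) :=
  Nat.rec (motive := fun _ => List (List C)) [[]]
    (fun _ ts => ts.flatMap fun t => D.map fun d => d :: t) n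
@[fun_prop] theorem ctuples {D : α → List C} {n : α → ℕ} (hD : Computable D)
    (hn : Computable n) : Computable fun a => tuples (D a) (n a) := by
  unfold tuples; fun_prop
theorem mem_tuples {D : List C} {n : ℕ} {cs : List C} :
    cs ∈ tuples D n ↔ cs.length = n ∧ ∀ c ∈ cs, c ∈ D := by
  induction n generalizing cs with
  | zero =>
    constructor
    · intro h; obtain rfl : cs = [] := by simpa [tuples] using h
      simp
    · rintro ⟨h, -⟩; obtain rfl := List.length_eq_zero_iff.1 h; simp [tuples]
  | succ n ih =>
    change cs ∈ (tuples D n).flatMap (fun t => D.map fun d => d :: t) ↔ _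
    rw [List.mem_flatMap]
    constructor
    · rintro ⟨t, ht, h⟩
      obtain ⟨d, hd, rfl⟩ := List.mem_map.1 h
      obtain ⟨h1, h2⟩ := ih.1 ht
      refine ⟨by simp [h1], ?_⟩
      intro c hc
      rcases List.mem_cons.1 hc with rfl | hc
      · exact hd
      · exact h2 c hc
    · rintro ⟨h1, h2⟩
      cases cs with
      | nil => simp at h1
      | cons d t =>
        exact ⟨t, ih.2 ⟨by simpa using h1, fun c hc => h2 c (by simp [hc])⟩,
          List.mem_map.2 ⟨d, h2 d (by simp), rfl⟩⟩

/-- Active domain. -/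
def adom (H : List (List (ℕ × List C))) : List C := H.flatMap fun s => s.flatMap fun ev => ev.2
@[fun_prop] theorem cadom {H : α → List (List (ℕ × List C))} (hH : Computable H) :
    Computable fun a => adom (H a) := by
  unfold adom; fun_prop

/-- Decode a list of variables. -/
def decVars (n : ℕ) : List ℕ := (Encodable.decode n : Option (List ℕ)).getD []
@[fun_prop] theorem cdecVars {n : α → ℕ} (hn : Computable n) :
    Computable fun a => decVars (n a) := by
  unfold decVars; fun_prop

/-- Subqueries of a quantifier with a positive guard. -/
def gq (c0 : C) (q : Qy C) : List (Qy C) :=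
  ((tuples (adom q.1) (decVars q.arg.unpair.1).length).filter fun cs =>
    pgEval c0 (q.bind (decVars q.arg.unpair.1) cs q.arg.unpair.2.unpair.1)).map fun cs =>
      q.bind (decVars q.arg.unpair.1) cs q.arg.unpair.2.unpair.2
@[fun_prop] theorem cgq (c0 : C) : Computable (gq c0) := by
  unfold gq; fun_prop

/-- Subqueries of a quantifier guarded by a predicate. -/
def aq (q : Qy C) : List (Qy C) :=
  (q.ev.filter fun ev => eqB (ev.1) (q.arg.unpair.2.unpair.1) &&
    eqB ev.2.length (decVars q.arg.unpair.1).length).map fun ev =>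
      q.bind (decVars q.arg.unpair.1) ev.2 q.arg.unpair.2.unpair.2
@[fun_prop] theorem caq : Computable (aq (C := C)) := by
  unfold aq; fun_prop

/-- Evaluate the terms in an atom. -/
def tms (F : ℕ → List C → C) (c0 : C) (q : Qy C) : List C :=
  (decVars q.arg.unpair.2).map fun n => tmEval F c0 q.2.2.1 n
theorem ctms {F : ℕ → List C → C} (hF : Computable fun q : ℕ × List C => F q.1 q.2) (c0 : C) :
    Computable (tms F c0) := by
  unfold tms
  have : Computable fun p : Qy C × ℕ => tmEval F c0 p.1.2.2.1 p.2 :=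
    ctmEval hF c0 (by fun_prop) (by fun_prop)
  fun_prop

/-- Step function for formulas. -/
def fmStep (F : ℕ → List C → C) (R : ℕ → List C → Bool) (c0 : C) (q : Qy C) : ℕ × List (Qy C) :=
  bif eqB (q.tag) (0) then leaf (memB (q.arg.unpair.1, tms F c0 q) q.ev)
  else bif eqB (q.tag) (1) then leaf (R q.arg.unpair.1 (tms F c0 q))
  else bif eqB (q.tag) (2) then (0, [q.sub q.arg.unpair.1, q.sub q.arg.unpair.2])
  else bif eqB (q.tag) (3) then (2, [q.sub q.arg])
  else bif eqB (q.tag) (4) then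
    (1, bif ltB 1 q.2.1 then [q.moved (q.2.1 - 1) q.arg] else [])
  else bif eqB (q.tag) (5) then (3, q.past q.arg.unpair.2 ++ q.past q.arg.unpair.1)
  else bif eqB (q.tag) (6) then (0, aq q)
  else bif eqB (q.tag) (7) then (0, gq c0 q)
  else (1, gq c0 q)

theorem cfmStep {F : ℕ → List C → C} {R : ℕ → List C → Bool}
    (hF : Computable fun q : ℕ × List C => F q.1 q.2)
    (hR : Computable fun q : ℕ × List C => R q.1 q.2) (c0 : C) :
    Computable (fmStep F R c0) := by
  unfold fmStep
  have h1 := ctms hF c0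
  have h2 : Computable fun q : Qy C => R q.arg.unpair.1 (tms F c0 q) :=
    hR.comp (g := fun q : Qy C => (q.arg.unpair.1, tms F c0 q)) (by fun_prop)
  fun_prop

/-! Correctness -/

/-- A list-of-lists history represents a history. -/
def Rep (H : List (List (ℕ × List C))) (h : History C) : Prop :=
  ∀ i ev, ev ∈ (H[i]?).getD [] ↔ ev ∈ h.getD i ∅

theorem finset_enc (s : Session C) : ∃ l : List (ℕ × List C),
    Encodable.encode s = Encodable.encode l ∧ ∀ ev, ev ∈ l ↔ ev ∈ s := by
  obtain ⟨l, hl⟩ : ∃ l : List (ℕ × List C), Encodable.encode s = Encodable.encode l := ⟨_, rfl⟩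
  refine ⟨l, hl, fun ev => ?_⟩
  have h1 : (Encodable.decode (Encodable.encode s.val) : Option (Multiset (ℕ × List C)))
      = some s.val := Encodable.encodek _
  have h2 : Encodable.encode s.val = Encodable.encode l := hl
  rw [h2] at h1
  change ((↑) : List (ℕ × List C) → Multiset (ℕ × List C)) <$>
    (Encodable.decode (Encodable.encode l) : Option (List (ℕ × List C))) = _ at h1
  rw [Encodable.encodek] at h1
  have h3 : (l : Multiset (ℕ × List C)) = s.val := Option.some.inj h1
  rw [← Finset.mem_val, ← h3, Multiset.mem_coe]

theorem hist_enc (h : History C) : ∃ H : List (List (ℕ × List C)),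
    Encodable.encode h = Encodable.encode H ∧ H.length = h.length ∧ Rep H h := by
  induction h with
  | nil => exact ⟨[], rfl, rfl, fun i ev => by simp⟩
  | cons s h ih =>
    obtain ⟨l, hl1, hl2⟩ := finset_enc s
    obtain ⟨H, h1, h2, h3⟩ := ih
    refine ⟨l :: H, ?_, by simp [h2], ?_⟩
    · rw [Encodable.encode_list_cons, Encodable.encode_list_cons, hl1, h1]
    · intro i ev
      cases i with
      | zero => simpa using hl2 ev
      | succ i => simpa using h3 i ev

theorem past_all (P : ℕ → Prop) (i : ℕ) :
    (∀ j, j < i → P (j + 1)) ↔ ∀ j, 1 ≤ j → j ≤ i → P j := by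
  constructor
  · intro h j h1 h2
    obtain ⟨j, rfl⟩ := Nat.exists_eq_add_of_le' h1
    exact h j (by omega)
  · intro h j hj; exact h _ (by omega) (by omega)

theorem past_any (P : ℕ → Prop) (i : ℕ) :
    (∃ j, j < i ∧ P (j + 1)) ↔ ∃ j, 1 ≤ j ∧ j ≤ i ∧ P j := by
  constructor
  · rintro ⟨j, h1, h2⟩; exact ⟨j + 1, by omega, by omega, h2⟩
  · rintro ⟨j, h1, h2, h3⟩
    obtain ⟨j, rfl⟩ := Nat.exists_eq_add_of_le' h1
    exact ⟨j, by omega, h3⟩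

theorem past_since (A B : ℕ → Prop) (i : ℕ) :
    (∃ j, j < i ∧ B (j + 1) ∧ ∀ m, j < m → m < i → A (m + 1)) ↔
      ∃ j, 1 ≤ j ∧ j ≤ i ∧ B j ∧ ∀ k, j < k → k ≤ i → A k := by
  constructor
  · rintro ⟨j, h1, h2, h3⟩
    refine ⟨j + 1, by omega, by omega, h2, fun k h4 h5 => ?_⟩
    obtain ⟨k, rfl⟩ := Nat.exists_eq_add_of_le' (show 1 ≤ k by omega)
    exact h3 k (by omega) (by omega)
  · rintro ⟨j, h1, h2, h3, h4⟩
    obtain ⟨j, rfl⟩ := Nat.exists_eq_add_of_le' h1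
    exact ⟨j, by omega, h3, fun m h5 h6 => h4 _ (by omega) (by omega)⟩

theorem enc2 {t a b k : ℕ} (ht : 1 ≤ t) (h : Nat.pair t (Nat.pair a b) < k + 1) :
    a < k ∧ b < k := by
  have := lt_pair (n := Nat.pair a b) ht
  have := Nat.left_le_pair a b
  have := Nat.right_le_pair a b
  omega

theorem enc1 {t a k : ℕ} (ht : 1 ≤ t) (h : Nat.pair t a < k + 1) : a < k := by
  have := lt_pair (n := a) ht
  omega

variable {H : List (List (ℕ × List C))} {h : History C}

theorem sg_correct (c0 : C) (hH : Rep H h) (e : List (ℕ × C)) (g : SG C) :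
    ∀ (k i : ℕ), g.enc < k →
      (bev (sgStep c0) k (H, i, e, g.enc) = true ↔ SG.sat h i (envVal c0 e) g) := by
  induction g with
  | atom p args =>
    intro k i hk
    obtain ⟨k, rfl⟩ := Nat.exists_eq_succ_of_ne_zero (Nat.ne_zero_of_lt hk)
    have hs : sgStep c0 (H, i, e, (SG.atom p args).enc) =
        leaf (memB (p, args.map (Sum.elim (envVal c0 e) id)) ((H[i - 1]?).getD [])) := by
      simp [sgStep, SG.enc, Qy.tag, Qy.arg, Qy.ev, eqB]
      rfl
    rw [bev_leaf hs, memB_iff, hH]; rfl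
  | and a b iha ihb =>
    intro k i hk
    obtain ⟨k, rfl⟩ := Nat.exists_eq_succ_of_ne_zero (Nat.ne_zero_of_lt hk)
    have hs : sgStep c0 (H, i, e, (SG.and a b).enc) = (0, [(H, i, e, a.enc), (H, i, e, b.enc)]) := by
      simp [sgStep, SG.enc, Qy.tag, Qy.arg, Qy.sub, eqB]
    obtain ⟨h1, h2⟩ := enc2 (by norm_num) hk
    rw [bev_all hs]
    simp [iha k i h1, ihb k i h2, SG.sat]
  | galw a iha =>
    intro k i hk
    obtain ⟨k, rfl⟩ := Nat.exists_eq_succ_of_ne_zero (Nat.ne_zero_of_lt hk)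
    have hs : sgStep c0 (H, i, e, (SG.galw a).enc) =
        (0, (List.range i).map fun j => (H, j + 1, e, a.enc)) := by
      simp [sgStep, SG.enc, Qy.tag, Qy.arg, Qy.past, Qy.moved, eqB]
    have h1 := enc1 (by norm_num) hk
    rw [bev_all hs, SG.sat, ← past_all]
    simp [iha k _ h1]
  | fsome a iha =>
    intro k i hk
    obtain ⟨k, rfl⟩ := Nat.exists_eq_succ_of_ne_zero (Nat.ne_zero_of_lt hk)
    have hs : sgStep c0 (H, i, e, (SG.fsome a).enc) =
        (1, (List.range i).map fun j => (H, j + 1, e, a.enc)) := by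
      simp [sgStep, SG.enc, Qy.tag, Qy.arg, Qy.past, Qy.moved, eqB]
    have h1 := enc1 (by norm_num) hk
    rw [bev_any hs, SG.sat, ← past_any]
    simp [iha k _ h1]

theorem pg_correct (c0 : C) (hH : Rep H h) (e : List (ℕ × C)) (g : PG C) :
    ∀ (k i : ℕ), g.enc < k →
      (bev (pgStep c0) k (H, i, e, g.enc) = true ↔ PG.sat h i (envVal c0 e) g) := by
  induction g with
  | simple g =>
    intro k i hk
    obtain ⟨k, rfl⟩ := Nat.exists_eq_succ_of_ne_zero (Nat.ne_zero_of_lt hk)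
    have hs : pgStep c0 (H, i, e, (PG.simple g).enc) = leaf (sgEval c0 (H, i, e, g.enc)) := by
      simp [pgStep, PG.enc, Qy.tag, Qy.arg, Qy.sub, eqB]
    rw [bev_leaf hs]
    exact sg_correct c0 hH e g _ i (Nat.lt_succ_self _)
  | and a b iha ihb =>
    intro k i hk
    obtain ⟨k, rfl⟩ := Nat.exists_eq_succ_of_ne_zero (Nat.ne_zero_of_lt hk)
    have hs : pgStep c0 (H, i, e, (PG.and a b).enc) = (0, [(H, i, e, a.enc), (H, i, e, b.enc)]) := by
      simp [pgStep, PG.enc, Qy.tag, Qy.arg, Qy.sub, eqB]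
    obtain ⟨h1, h2⟩ := enc2 (by norm_num) hk
    rw [bev_all hs]
    simp [iha k i h1, ihb k i h2, PG.sat]
  | or a b iha ihb =>
    intro k i hk
    obtain ⟨k, rfl⟩ := Nat.exists_eq_succ_of_ne_zero (Nat.ne_zero_of_lt hk)
    have hs : pgStep c0 (H, i, e, (PG.or a b).enc) = (1, [(H, i, e, a.enc), (H, i, e, b.enc)]) := by
      simp [pgStep, PG.enc, Qy.tag, Qy.arg, Qy.sub, eqB]
    obtain ⟨h1, h2⟩ := enc2 (by norm_num) hk
    rw [bev_any hs]
    simp [iha k i h1, ihb k i h2, PG.sat]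
  | galw a iha =>
    intro k i hk
    obtain ⟨k, rfl⟩ := Nat.exists_eq_succ_of_ne_zero (Nat.ne_zero_of_lt hk)
    have hs : pgStep c0 (H, i, e, (PG.galw a).enc) =
        (0, (List.range i).map fun j => (H, j + 1, e, a.enc)) := by
      simp [pgStep, PG.enc, Qy.tag, Qy.arg, Qy.past, Qy.moved, eqB]
    have h1 := enc1 (by norm_num) hk
    rw [bev_all hs, PG.sat, ← past_all]
    simp [iha k _ h1]
  | fsome a iha =>
    intro k i hk
    obtain ⟨k, rfl⟩ := Nat.exists_eq_succ_of_ne_zero (Nat.ne_zero_of_lt hk)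
    have hs : pgStep c0 (H, i, e, (PG.fsome a).enc) =
        (1, (List.range i).map fun j => (H, j + 1, e, a.enc)) := by
      simp [pgStep, PG.enc, Qy.tag, Qy.arg, Qy.past, Qy.moved, eqB]
    have h1 := enc1 (by norm_num) hk
    rw [bev_any hs, PG.sat, ← past_any]
    simp [iha k _ h1]
  | since a b iha ihb =>
    intro k i hk
    obtain ⟨k, rfl⟩ := Nat.exists_eq_succ_of_ne_zero (Nat.ne_zero_of_lt hk)
    have hs : pgStep c0 (H, i, e, (PG.since a b).enc) =
        (3, (List.range i).map (fun j => (H, j + 1, e, b.enc)) ++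
          (List.range i).map (fun j => (H, j + 1, e, a.enc))) := by
      simp [pgStep, PG.enc, Qy.tag, Qy.arg, Qy.past, Qy.moved, eqB]
    obtain ⟨h1, h2⟩ := enc2 (by norm_num) hk
    rw [bev_since hs, PG.sat, ← past_since]
    simp [iha k _ h1, ihb k _ h2]

theorem mem_adom (hH : Rep H h) {i p : ℕ} {cs : List C} (hm : (p, cs) ∈ h.getD i ∅) {c : C}
    (hc : c ∈ cs) : c ∈ adom H := by
  rw [← hH] at hm
  unfold adom
  rcases hs : H[i]? with _ | s
  · simp [hs] at hm
  · rw [hs] at hm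
    exact List.mem_flatMap.2 ⟨s, List.mem_of_getElem? hs,
      List.mem_flatMap.2 ⟨(p, cs), by simpa using hm, hc⟩⟩

theorem sg_dom (hH : Rep H h) {ρ : ℕ → C} (g : SG C) : ∀ i, 1 ≤ i → SG.sat h i ρ g →
    ∀ x ∈ g.vars, ρ x ∈ adom H := by
  induction g with
  | atom p args =>
    intro i _ hs x hx
    rw [SG.sat] at hs
    rw [SG.vars, List.mem_filterMap] at hx
    obtain ⟨u, hu, hux⟩ := hx
    refine mem_adom hH hs (List.mem_map.2 ⟨u, hu, ?_⟩)
    rcases u with u | u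
    · simp at hux; simp [hux]
    · simp at hux
  | and a b iha ihb =>
    intro i hi hs x hx
    rw [SG.vars, List.mem_append] at hx
    rcases hx with hx | hx
    · exact iha i hi hs.1 x hx
    · exact ihb i hi hs.2 x hx
  | galw a iha => exact fun i hi hs x hx => iha i hi (hs i hi le_rfl) x hx
  | fsome a iha =>
    rintro i hi ⟨j, h1, h2, h3⟩ x hx
    exact iha j h1 h3 x hx

theorem pg_dom (hH : Rep H h) {ρ : ℕ → C} {xs : List ℕ} (g : PG C) (ho : g.Over xs) :
    ∀ i, 1 ≤ i → PG.sat h i ρ g → ∀ x ∈ xs, ρ x ∈ adom H := by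
  induction g with
  | simple g => exact fun i hi hs x hx => sg_dom hH g i hi hs x ((ho x).2 hx)
  | and a b iha ihb => exact fun i hi hs x hx => iha ho.1 i hi hs.1 x hx
  | or a b iha ihb =>
    rintro i hi (hs | hs) x hx
    · exact iha ho.1 i hi hs x hx
    · exact ihb ho.2 i hi hs x hx
  | galw a iha => exact fun i hi hs x hx => iha ho i hi (hs i hi le_rfl) x hx
  | fsome a iha =>
    rintro i hi ⟨j, h1, h2, h3⟩ x hx
    exact iha ho j h1 h3 x hx
  | since a b iha ihb =>
    rintro i hi ⟨j, h1, h2, h3, -⟩ x hx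
    exact ihb ho.2 j h1 h3 x hx

theorem exists_var {ρ : ℕ → C} {xs : List ℕ} {cs : List C} (hx : xs.Nodup)
    (hl : cs.length = xs.length) : ∀ c ∈ cs, ∃ x ∈ xs, updEnv ρ xs cs x = c := by
  induction xs generalizing cs with
  | nil =>
    obtain rfl := List.length_eq_zero_iff.1 hl
    simp
  | cons x xs ih =>
    cases cs with
    | nil => simp
    | cons d cs =>
      intro c hc
      rcases List.mem_cons.1 hc with rfl | hc
      · exact ⟨x, by simp, by simp [updEnv]⟩
      · obtain ⟨y, hy, hyc⟩ := ih (List.nodup_cons.1 hx).2 (by simpa using hl) c hc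
        refine ⟨y, by simp [hy], ?_⟩
        have hne : (y == x) = false := by
          simp only [beq_eq_false_iff_ne]
          rintro rfl
          exact (List.nodup_cons.1 hx).1 hy
        rw [← hyc]
        simp [updEnv, List.lookup_cons, hne]

theorem mem_gq (c0 : C) (hH : Rep H h) {i : ℕ} (hi : 1 ≤ i) {e : List (ℕ × C)} {xs : List ℕ}
    {G : PG C} {t n : ℕ} (hx : xs.Nodup) (ho : G.Over xs) (q : Qy C) :
    q ∈ gq c0 (H, i, e, Nat.pair t (Nat.pair (Encodable.encode xs) (Nat.pair G.enc n))) ↔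
      ∃ cs : List C, cs.length = xs.length ∧ PG.sat h i (updEnv (envVal c0 e) xs cs) G ∧
        q = (H, i, xs.zip cs ++ e, n) := by
  have key : ∀ cs : List C, pgEval c0 (H, i, xs.zip cs ++ e, G.enc) = true ↔
      PG.sat h i (updEnv (envVal c0 e) xs cs) G := by
    intro cs
    rw [← envVal_upd]
    exact pg_correct c0 hH _ G _ i (Nat.lt_succ_self _)
  simp only [gq, Qy.arg, Qy.bind, decVars, Nat.unpair_pair, Encodable.encodek, Option.getD_some,
    List.mem_map, List.mem_filter, key, mem_tuples]
  constructor
  · rintro ⟨cs, ⟨⟨h1, h2⟩, h3⟩, rfl⟩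
    exact ⟨cs, h1, h3, rfl⟩
  · rintro ⟨cs, h1, h3, rfl⟩
    refine ⟨cs, ⟨⟨h1, ?_⟩, h3⟩, rfl⟩
    intro c hc
    obtain ⟨x, hx1, rfl⟩ := exists_var (ρ := envVal c0 e) hx h1 c hc
    exact pg_dom hH G ho i hi h3 x hx1

theorem mem_aq (hH : Rep H h) {i : ℕ} {e : List (ℕ × C)} {xs : List ℕ}
    {p t n : ℕ} (q : Qy C) :
    q ∈ aq (H, i, e, Nat.pair t (Nat.pair (Encodable.encode xs) (Nat.pair p n))) ↔
      ∃ cs : List C, cs.length = xs.length ∧ (p, cs) ∈ h.getD (i - 1) ∅ ∧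
        q = (H, i, xs.zip cs ++ e, n) := by
  simp only [aq, Qy.arg, Qy.bind, Qy.ev, decVars, Nat.unpair_pair, Encodable.encodek,
    Option.getD_some, List.mem_map, List.mem_filter, Bool.and_eq_true, eqB_iff, hH (i - 1)]
  constructor
  · rintro ⟨⟨p', cs⟩, ⟨h1, rfl, h3⟩, rfl⟩
    exact ⟨cs, h3, h1, rfl⟩
  · rintro ⟨cs, h1, h3, rfl⟩
    exact ⟨(p, cs), ⟨h3, rfl, h1⟩, rfl⟩

theorem tms_eq (F : ℕ → List C → C) (c0 : C) (i : ℕ) (e : List (ℕ × C)) (t p : ℕ)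
    (ts : List (Tm C)) :
    tms F c0 (H, i, e, Nat.pair t (Nat.pair p (Encodable.encode (ts.map Tm.enc)))) =
      ts.map (Tm.eval F (envVal c0 e)) := by
  simp only [tms, Qy.arg, decVars, Nat.unpair_pair, Encodable.encodek, Option.getD_some,
    List.map_map]
  exact List.map_congr_left fun t _ => tmEval_eq F c0 e t

theorem fm_correct (F : ℕ → List C → C) (R : ℕ → List C → Bool) (c0 : C) (hH : Rep H h)
    (φ : FmP C) : ∀ (k i : ℕ) (e : List (ℕ × C)), φ.WFm → 1 ≤ i → φ.enc < k →
      (bev (fmStep F R c0) k (H, i, e, φ.enc) = true ↔ SatP F R h i (envVal c0 e) φ) := by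
  induction φ with
  | atom p ts =>
    intro k i e _ _ hk
    obtain ⟨k, rfl⟩ := Nat.exists_eq_succ_of_ne_zero (Nat.ne_zero_of_lt hk)
    have hs : fmStep F R c0 (H, i, e, (FmP.atom p ts).enc) =
        leaf (memB (p, ts.map (Tm.eval F (envVal c0 e))) ((H[i - 1]?).getD [])) := by
      rw [← tms_eq (H := H) F c0 i e 0 p ts]
      simp [fmStep, FmP.enc, Qy.tag, Qy.arg, Qy.ev, eqB]
    rw [bev_leaf hs, memB_iff, hH]; rfl
  | rel p ts =>
    intro k i e _ _ hk
    obtain ⟨k, rfl⟩ := Nat.exists_eq_succ_of_ne_zero (Nat.ne_zero_of_lt hk)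
    have hs : fmStep F R c0 (H, i, e, (FmP.rel p ts).enc) =
        leaf (R p (ts.map (Tm.eval F (envVal c0 e)))) := by
      rw [← tms_eq (H := H) F c0 i e 1 p ts]
      simp [fmStep, FmP.enc, Qy.tag, Qy.arg, eqB]
    rw [bev_leaf hs]; rfl
  | and a b iha ihb =>
    intro k i e hw hi hk
    obtain ⟨k, rfl⟩ := Nat.exists_eq_succ_of_ne_zero (Nat.ne_zero_of_lt hk)
    have hs : fmStep F R c0 (H, i, e, (FmP.and a b).enc) =
        (0, [(H, i, e, a.enc), (H, i, e, b.enc)]) := by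
      simp [fmStep, FmP.enc, Qy.tag, Qy.arg, Qy.sub, eqB]
    obtain ⟨h1, h2⟩ := enc2 (by norm_num) hk
    rw [bev_all hs]
    simp [iha k i e hw.1 hi h1, ihb k i e hw.2 hi h2, SatP]
  | not a iha =>
    intro k i e hw hi hk
    obtain ⟨k, rfl⟩ := Nat.exists_eq_succ_of_ne_zero (Nat.ne_zero_of_lt hk)
    have hs : fmStep F R c0 (H, i, e, (FmP.not a).enc) = (2, [(H, i, e, a.enc)]) := by
      simp [fmStep, FmP.enc, Qy.tag, Qy.arg, Qy.sub, eqB]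
    have h1 := enc1 (by norm_num) hk
    rw [bev_not hs, iha k i e hw hi h1, SatP]
  | prev a iha =>
    intro k i e hw hi hk
    obtain ⟨k, rfl⟩ := Nat.exists_eq_succ_of_ne_zero (Nat.ne_zero_of_lt hk)
    have hs : fmStep F R c0 (H, i, e, (FmP.prev a).enc) =
        (1, bif ltB 1 i then [(H, i - 1, e, a.enc)] else []) := by
      simp [fmStep, FmP.enc, Qy.tag, Qy.arg, Qy.moved, eqB]
    have h1 := enc1 (by norm_num) hk
    rw [bev_any hs, SatP]
    by_cases h2 : 1 < i
    · have h3 : ltB 1 i = true := by simpa using h2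
      rw [h3]
      simp [iha k (i - 1) e hw (by omega) h1, h2]
    · have h3 : ltB 1 i = false := by simpa [ltB] using h2
      rw [h3]
      simp [h2]
  | since a b iha ihb =>
    intro k i e hw hi hk
    obtain ⟨k, rfl⟩ := Nat.exists_eq_succ_of_ne_zero (Nat.ne_zero_of_lt hk)
    have hs : fmStep F R c0 (H, i, e, (FmP.since a b).enc) =
        (3, (List.range i).map (fun j => (H, j + 1, e, b.enc)) ++
          (List.range i).map (fun j => (H, j + 1, e, a.enc))) := by
      simp [fmStep, FmP.enc, Qy.tag, Qy.arg, Qy.past, Qy.moved, eqB]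
    obtain ⟨h1, h2⟩ := enc2 (by norm_num) hk
    have ha := fun j => iha k (j + 1) e hw.1 (by omega) h1
    have hb := fun j => ihb k (j + 1) e hw.2 (by omega) h2
    rw [bev_since hs, SatP, ← past_since]
    simp only [ha, hb]
  | all xs p a iha =>
    intro k i e hw hi hk
    obtain ⟨k, rfl⟩ := Nat.exists_eq_succ_of_ne_zero (Nat.ne_zero_of_lt hk)
    have hs : fmStep F R c0 (H, i, e, (FmP.all xs p a).enc) =
        (0, aq (H, i, e, (FmP.all xs p a).enc)) := by
      simp [fmStep, FmP.enc, Qy.tag, eqB]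
    have h1 := (enc2 (by norm_num) hk).2
    have h2 : a.enc < k := (Nat.right_le_pair _ _).trans_lt h1
    rw [bev_all hs, SatP]
    simp only [FmP.enc, mem_aq hH]
    constructor
    · intro hq cs h3 h4
      rw [← envVal_upd, ← iha k i _ hw hi h2]
      exact hq _ ⟨cs, h3, h4, rfl⟩
    · rintro hq _ ⟨cs, h3, h4, rfl⟩
      rw [iha k i _ hw hi h2, envVal_upd]
      exact hq cs h3 h4
  | allG xs G a iha =>
    intro k i e hw hi hk
    obtain ⟨k, rfl⟩ := Nat.exists_eq_succ_of_ne_zero (Nat.ne_zero_of_lt hk)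
    have hs : fmStep F R c0 (H, i, e, (FmP.allG xs G a).enc) =
        (0, gq c0 (H, i, e, (FmP.allG xs G a).enc)) := by
      simp [fmStep, FmP.enc, Qy.tag, eqB]
    have h1 := (enc2 (by norm_num) hk).2
    have h2 : a.enc < k := (Nat.right_le_pair _ _).trans_lt h1
    obtain ⟨hw1, hw2, hw⟩ := hw
    rw [bev_all hs, SatP]
    simp only [FmP.enc, mem_gq c0 hH hi hw1 hw2]
    constructor
    · intro hq cs h3 h4
      rw [← envVal_upd, ← iha k i _ hw hi h2]
      exact hq _ ⟨cs, h3, h4, rfl⟩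
    · rintro hq _ ⟨cs, h3, h4, rfl⟩
      rw [iha k i _ hw hi h2, envVal_upd]
      exact hq cs h3 h4
  | exG xs G a iha =>
    intro k i e hw hi hk
    obtain ⟨k, rfl⟩ := Nat.exists_eq_succ_of_ne_zero (Nat.ne_zero_of_lt hk)
    have hs : fmStep F R c0 (H, i, e, (FmP.exG xs G a).enc) =
        (1, gq c0 (H, i, e, (FmP.exG xs G a).enc)) := by
      simp [fmStep, FmP.enc, Qy.tag, eqB]
    have h1 := (enc2 (by norm_num) hk).2
    have h2 : a.enc < k := (Nat.right_le_pair _ _).trans_lt h1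
    obtain ⟨hw1, hw2, hw⟩ := hw
    rw [bev_any hs, SatP]
    simp only [FmP.enc, mem_gq c0 hH hi hw1 hw2]
    constructor
    · rintro ⟨_, ⟨cs, h3, h4, rfl⟩, h5⟩
      rw [iha k i _ hw hi h2, envVal_upd] at h5
      exact ⟨cs, h3, h4, h5⟩
    · rintro ⟨cs, h3, h4, h5⟩
      rw [← envVal_upd, ← iha k i _ hw hi h2] at h5
      exact ⟨_, ⟨cs, h3, h4, rfl⟩, h5⟩

end env

/-! Locality -/
section loc
variable {C : Type} {h : History C}

theorem tm_loc (F : ℕ → List C → C) {ρ ρ' : ℕ → C} :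
    ∀ (t : Tm C), (∀ x ∈ t.fv, ρ x = ρ' x) → t.eval F ρ = t.eval F ρ'
  | .var x, hx => by simpa [Tm.eval, Tm.fv] using hx
  | .const c, hx => by simp [Tm.eval]
  | .func f args, hx => by
    rw [Tm.eval, Tm.eval]
    congr 1
    apply List.map_congr_left
    rintro ⟨t, ht⟩ _
    apply tm_loc F t
    intro x hxt
    apply hx
    rw [Tm.fv, List.mem_flatMap]
    exact ⟨⟨t, ht⟩, List.mem_attach _ _, hxt⟩
  termination_by t => sizeOf t
  decreasing_by simp_wf; have := List.sizeOf_lt_of_mem ht; omega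

theorem tms_loc (F : ℕ → List C → C) {ρ ρ' : ℕ → C} {ts : List (Tm C)}
    (hx : ∀ x ∈ ts.flatMap Tm.fv, ρ x = ρ' x) : ts.map (Tm.eval F ρ) = ts.map (Tm.eval F ρ') :=
  List.map_congr_left fun t ht => tm_loc F t fun x hxt =>
    hx x (List.mem_flatMap.2 ⟨t, ht, hxt⟩)

theorem sg_loc {ρ ρ' : ℕ → C} (g : SG C) (hx : ∀ x ∈ g.vars, ρ x = ρ' x) :
    ∀ i, SG.sat h i ρ g ↔ SG.sat h i ρ' g := by
  induction g with
  | atom p args =>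
    intro i
    rw [SG.sat, SG.sat]
    have : args.map (Sum.elim ρ id) = args.map (Sum.elim ρ' id) := by
      apply List.map_congr_left
      rintro (u | u) hu
      · exact hx u (List.mem_filterMap.2 ⟨_, hu, rfl⟩)
      · rfl
    rw [this]
  | and a b iha ihb =>
    simp only [SG.vars, List.mem_append] at hx
    intro i
    simp only [SG.sat, iha fun x h => hx x (.inl h), ihb fun x h => hx x (.inr h)]
  | galw a iha => intro i; simp only [SG.sat, iha hx]
  | fsome a iha => intro i; simp only [SG.sat, iha hx]

theorem pg_loc {ρ ρ' : ℕ → C} (g : PG C) (hx : ∀ x ∈ g.vars, ρ x = ρ' x) :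
    ∀ i, PG.sat h i ρ g ↔ PG.sat h i ρ' g := by
  induction g with
  | simple g => exact sg_loc g hx
  | and a b iha ihb =>
    simp only [PG.vars, List.mem_append] at hx
    intro i
    simp only [PG.sat, iha fun x h => hx x (.inl h), ihb fun x h => hx x (.inr h)]
  | or a b iha ihb =>
    simp only [PG.vars, List.mem_append] at hx
    intro i
    simp only [PG.sat, iha fun x h => hx x (.inl h), ihb fun x h => hx x (.inr h)]
  | galw a iha => intro i; simp only [PG.sat, iha hx]
  | fsome a iha => intro i; simp only [PG.sat, iha hx]
  | since a b iha ihb =>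
    simp only [PG.vars, List.mem_append] at hx
    intro i
    simp only [PG.sat, iha fun x h => hx x (.inl h), ihb fun x h => hx x (.inr h)]

theorem lookup_zip {xs : List ℕ} {cs : List C} (hl : cs.length = xs.length) {x : ℕ}
    (hx : x ∈ xs) : ∃ c, (xs.zip cs).lookup x = some c := by
  induction xs generalizing cs with
  | nil => simp at hx
  | cons y xs ih =>
    cases cs with
    | nil => simp at hl
    | cons c cs =>
      rw [List.zip_cons_cons, List.lookup_cons]
      cases hxy : x == y with
      | true => exact ⟨c, rfl⟩
      | false =>
        refine ih (by simpa using hl) ?_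
        rcases List.mem_cons.1 hx with rfl | h
        · simp at hxy
        · exact h

theorem upd_loc {ρ ρ' : ℕ → C} {xs : List ℕ} {cs : List C} (hl : cs.length = xs.length)
    {l : List ℕ} (hx : ∀ x ∈ l.filter (fun v => v ∉ xs), ρ x = ρ' x) :
    ∀ x ∈ l, updEnv ρ xs cs x = updEnv ρ' xs cs x := by
  intro x hxl
  unfold updEnv
  by_cases h : x ∈ xs
  · obtain ⟨c, hc⟩ := lookup_zip hl h
    rw [hc]; rfl
  · rw [hx x (List.mem_filter.2 ⟨hxl, by simpa using h⟩)]

theorem fm_loc (F : ℕ → List C → C) (R : ℕ → List C → Bool) (φ : FmP C) :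
    ∀ (i : ℕ) (ρ ρ' : ℕ → C), (∀ x ∈ φ.fv, ρ x = ρ' x) →
      (SatP F R h i ρ φ ↔ SatP F R h i ρ' φ) := by
  induction φ with
  | atom p ts => intro i ρ ρ' hx; rw [SatP, SatP, tms_loc F hx]
  | rel p ts => intro i ρ ρ' hx; rw [SatP, SatP, tms_loc F hx]
  | and a b iha ihb =>
    intro i ρ ρ' hx
    simp only [FmP.fv, List.mem_append] at hx
    simp only [SatP, iha i ρ ρ' fun x h => hx x (.inl h), ihb i ρ ρ' fun x h => hx x (.inr h)]
  | not a iha => intro i ρ ρ' hx; simp only [SatP, iha i ρ ρ' hx]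
  | prev a iha => intro i ρ ρ' hx; simp only [SatP, iha (i - 1) ρ ρ' hx]
  | since a b iha ihb =>
    intro i ρ ρ' hx
    simp only [FmP.fv, List.mem_append] at hx
    have ha := fun i => iha i ρ ρ' fun x h => hx x (.inl h)
    have hb := fun i => ihb i ρ ρ' fun x h => hx x (.inr h)
    simp only [SatP, ha, hb]
  | all xs p a iha =>
    intro i ρ ρ' hx
    rw [SatP, SatP]
    refine forall_congr' fun cs => forall_congr' fun hl => forall_congr' fun _ => ?_
    exact iha i _ _ (upd_loc hl hx)
  | allG xs G a iha =>
    intro i ρ ρ' hx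
    rw [SatP, SatP]
    refine forall_congr' fun cs => forall_congr' fun hl => ?_
    have hu := upd_loc hl hx
    rw [iha i _ _ fun x h => hu x (List.mem_append_right _ h),
      pg_loc G (fun x h => hu x (List.mem_append_left _ h)) i]
  | exG xs G a iha =>
    intro i ρ ρ' hx
    rw [SatP, SatP]
    refine exists_congr fun cs => and_congr_right fun hl => ?_
    have hu := upd_loc hl hx
    rw [iha i _ _ fun x h => hu x (List.mem_append_right _ h),
      pg_loc G (fun x h => hu x (List.mem_append_left _ h)) i]

end loc
end MC

/-- Assume constants range over a Primcodable type with computable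
equality, computable interpreted functions, and computable interpreted relations.
Then model checking for PTLTL^FO+ is decidable: there is a computable function which,
given (the natural encodings of) a history `h` and a closed PTLTL^FO+ formula `φ`,
returns `true` if `h ⊨ φ` and `false` otherwise. -/
theorem ptltlfop_modelchecking_decidable {C : Type} [Primcodable C] [DecidableEq C]
    (F : ℕ → List C → C) (R : ℕ → List C → Bool)
    (hEq : Computable fun q : C × C => decide (q.1 = q.2))
    (hF : Computable fun q : ℕ × List C => F q.1 q.2)
    (hR : Computable fun q : ℕ × List C => R q.1 q.2) :
    ∃ f : ℕ → Bool, Computable f ∧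
      ∀ (h : History C) (φ : FmP C), h ≠ [] → φ.Closed → φ.WFm →
        (f (Nat.pair (Encodable.encode h) φ.enc) = true ↔
          ∀ ρ : ℕ → C, SatP F R h h.length ρ φ) := by
  let c0 : C := F 0 []
  let dec : ℕ → List (List (ℕ × List C)) := fun n =>
    (Encodable.decode n.unpair.1 : Option (List (List (ℕ × List C)))).getD []
  have hdec : Computable dec := by
    change Computable fun n =>
      (Encodable.decode (Nat.unpair n).1 : Option (List (List (ℕ × List C)))).getD []
    fun_prop
  refine ⟨fun n => MC.bev (MC.fmStep F R c0) (n.unpair.2 + 1)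
    (dec n, (dec n).length, [], n.unpair.2), ?_, ?_⟩
  · exact MC.cbev (MC.cfmStep hF hR c0) (by fun_prop) (by fun_prop)
  · intro h φ hne hcl hwf
    obtain ⟨H, h1, h2, h3⟩ := MC.hist_enc h
    have hd : dec (Nat.pair (Encodable.encode h) φ.enc) = H := by
      simp only [dec, Nat.unpair_pair, h1, Encodable.encodek, Option.getD_some]
    have hlen : 1 ≤ h.length := List.length_pos_iff.2 hne
    simp only [hd, Nat.unpair_pair, h2]
    rw [MC.fm_correct F R c0 h3 φ _ _ [] hwf hlen (Nat.lt_succ_self _)]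
    have hfv : φ.fv = [] := hcl
    constructor
    · intro hs ρ
      exact (MC.fm_loc F R φ _ _ _ (by simp [hfv])).1 hs
    · intro hs
      exact hs _
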